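/- arXiv:1703.08123 — 4 statements merged into one kernel-verified Lean document; each statement's English description precedes it below -/
import Mathlib

section
/- Every finite complete multidigraph has fractional domination number at most 2: if V is a finite nonempty set equipped with relations P_1, …, P_k such that for every pair of distinct vertices x, y there is some i with P_i x y or P_i y x, then there exists a probability distribution w on V such that w(N^-(x)) ≥ 1/2 for every x ∈ V, where N^-(x) denotes the closed in-neighbourhood {x} ∪ {y : P_i y x for some i}. -/
/-- The total weight of a set `S` under a weight function `w`. -/
noncomputable def setWeight {V : Type*} [Fintype V] (w : V → ℝ) (S : Set V) : ℝ :=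
  ∑ x, S.indicator w x

/-- The quadratic form of a matrix whose symmetrization is entrywise nonnegative is nonnegative on
nonnegative vectors. -/
theorem Matrix.dotProduct_mulVec_self_nonneg_of_add_transpose_nonneg {V : Type*} [Fintype V]
    {B : Matrix V V ℝ} (hB : ∀ x y, 0 ≤ B x y + B y x) {c : V → ℝ} (hc : ∀ x, 0 ≤ c x) :
    0 ≤ c ⬝ᵥ B.mulVec c := by
  have hexpand : c ⬝ᵥ B.mulVec c = ∑ x, ∑ y, c x * c y * B x y := by
    simp only [dotProduct, Matrix.mulVec, Finset.mul_sum]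
    exact Finset.sum_congr rfl fun x _ => Finset.sum_congr rfl fun y _ => by ring
  have hswap : c ⬝ᵥ B.mulVec c = ∑ x, ∑ y, c x * c y * B y x := by
    rw [hexpand, Finset.sum_comm]
    exact Finset.sum_congr rfl fun x _ => Finset.sum_congr rfl fun y _ => by ring
  have hdouble : 0 ≤ c ⬝ᵥ B.mulVec c + c ⬝ᵥ B.mulVec c := by
    nth_rewrite 1 [hexpand]
    rw [hswap]
    simp only [← Finset.sum_add_distrib, ← mul_add]
    exact Finset.sum_nonneg fun x _ => Finset.sum_nonneg fun y _ =>
      mul_nonneg (mul_nonneg (hc x) (hc y)) (hB x y)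
  linarith

/-- A matrix game whose payoff matrix has entrywise nonnegative symmetrization admits a mixed
strategy with nonnegative payoff against every pure strategy. -/
theorem Matrix.exists_mem_stdSimplex_mulVec_nonneg {V : Type*} [Fintype V] [Nonempty V]
    {B : Matrix V V ℝ} (hB : ∀ x y, 0 ≤ B x y + B y x) :
    ∃ w ∈ stdSimplex ℝ V, ∀ x, 0 ≤ B.mulVec w x := by
  classical
  by_contra! hneg
  have hdisj : Disjoint (B.mulVecLin '' stdSimplex ℝ V) (Set.Ici 0) := by
    rw [Set.disjoint_left]
    rintro _ ⟨w, hw, rfl⟩ hnonneg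
    obtain ⟨x, hx⟩ := hneg w hw
    exact absurd (hnonneg x) (not_le.mpr hx)
  obtain ⟨f, u, v, hfu, huv, hvf⟩ := geometric_hahn_banach_compact_closed
    ((convex_stdSimplex ℝ V).linear_image B.mulVecLin)
    ((isCompact_stdSimplex ℝ V).image B.mulVecLin.continuous_of_finiteDimensional)
    (convex_Ici 0) isClosed_Ici hdisj
  have hv : v < 0 := by simpa using hvf 0 (Set.mem_Ici.mpr le_rfl)
  set c : V → ℝ := fun x => f (Pi.single x 1) with hc_def
  have hf : ∀ z, f z = c ⬝ᵥ z := fun z => by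
    conv_lhs => rw [pi_eq_sum_univ' z]
    simp [hc_def, dotProduct, mul_comm]
  have hc : ∀ x, 0 ≤ c x := by
    intro x
    by_contra! hx
    have hz := hvf ((v / c x) • Pi.single x 1)
      (Set.mem_Ici.mpr <| smul_nonneg (div_nonneg_of_nonpos hv.le hx.le) (Pi.single_nonneg.mpr zero_le_one))
    rw [map_smul, smul_eq_mul, div_mul_cancel₀ v hx.ne] at hz
    exact lt_irrefl v hz
  have hsum : 0 < ∑ x, c x := by
    refine (Finset.sum_nonneg fun x _ => hc x).lt_of_ne fun hzero => ?_
    have hc0 : c = 0 := funext fun x =>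
      (Finset.sum_eq_zero_iff_of_nonneg fun x _ => hc x).mp hzero.symm x (Finset.mem_univ x)
    have hlt := hfu _ (Set.mem_image_of_mem _ (single_mem_stdSimplex ℝ (Classical.arbitrary V)))
    rw [hf, hc0, zero_dotProduct] at hlt
    linarith
  have hmem : (∑ x, c x)⁻¹ • c ∈ stdSimplex ℝ V :=
    ⟨fun x => mul_nonneg (inv_nonneg.mpr hsum.le) (hc x), by
      simp [← Finset.mul_sum, inv_mul_cancel₀ hsum.ne']⟩
  have hlt := hfu _ (Set.mem_image_of_mem _ hmem)
  rw [map_smul, map_smul, hf, Matrix.mulVecLin_apply, smul_eq_mul] at hlt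
  have hnonneg := mul_nonneg (inv_nonneg.mpr hsum.le)
    (Matrix.dotProduct_mulVec_self_nonneg_of_add_transpose_nonneg hB hc)
  linarith

/-- Every finite complete multidigraph has fractional domination number at most 2:
if `V` is a finite nonempty set with relations `P 1, …, P k` such that any two distinct
vertices are joined by an arc in some `P i`, then there is a probability distribution `w`
on `V` with `w(N⁻(x)) ≥ 1/2` for every `x`, where `N⁻(x) = {x} ∪ {y | ∃ i, P i y x}`. -/
theorem fractional_domination_of_complete_multidigraph
    {V : Type*} [Fintype V] [Nonempty V] {k : ℕ}
    (P : Fin k → V → V → Prop)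
    (hcomplete : ∀ x y : V, x ≠ y → ∃ i, P i x y ∨ P i y x) :
    ∃ w : V → ℝ, (∀ x, 0 ≤ w x ∧ w x ≤ 1) ∧ (∑ x, w x) = 1 ∧
      ∀ x : V, setWeight w {y | y = x ∨ ∃ i, P i y x} ≥ 1 / 2 := by
  classical
  let N : V → Set V := fun x => {y | y = x ∨ ∃ i, P i y x}
  let B : Matrix V V ℝ := fun x y => (if y ∈ N x then 1 else 0) - 1 / 2
  have hN : ∀ x y, y ∈ N x ∨ x ∈ N y := by
    intro x y
    rcases eq_or_ne x y with rfl | hxy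
    · exact Or.inl (Or.inl rfl)
    · obtain ⟨i, h | h⟩ := hcomplete x y hxy
      · exact Or.inr (Or.inr ⟨i, h⟩)
      · exact Or.inl (Or.inr ⟨i, h⟩)
  have hB : ∀ x y, 0 ≤ B x y + B y x := by
    intro x y
    rcases hN x y with h | h <;> simp only [B, if_pos h] <;> split_ifs <;> norm_num
  obtain ⟨w, ⟨hw, hw1⟩, hBw⟩ := Matrix.exists_mem_stdSimplex_mulVec_nonneg hB
  refine ⟨w, fun x => ⟨hw x, ?_⟩, hw1, fun x => ?_⟩
  · exact hw1 ▸ Finset.single_le_sum (fun y _ => hw y) (Finset.mem_univ x)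
  · have hweight : B.mulVec w x = setWeight w (N x) - 1 / 2 := by
      simp only [Matrix.mulVec, dotProduct, B, sub_mul, Finset.sum_sub_distrib, ← Finset.mul_sum,
        hw1, setWeight, Set.indicator_apply, ite_mul, one_mul, zero_mul, mul_one]
    exact sub_nonneg.mp (hweight ▸ hBw x)
end

section
/- Let T be a complete multidigraph on a finite nonempty vertex set V whose arc set is the union of k quasi-orders P_1, …, P_k (k ≥ 1). Then there exists a probability distribution w on V and a partition of V into sets T_1, T_2, …, T_k such that for every i ∈ {1,…,k} and every x ∈ T_i, one has w(N_i^-(x)) ≥ 1/(2k), where N_i^-(x) = {x} ∪ {y ∈ V : P_i y x}. -/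
/-- The symmetric zero-sum game with skew-symmetric payoff `b` has an optimal mixed strategy of
nonnegative value. -/
theorem exists_stdSimplex_sum_nonneg_of_skew {V : Type*} [Fintype V] [Nonempty V]
    (b : V → V → ℝ) (hb : ∀ x y, b x y = -b y x) :
    ∃ w ∈ stdSimplex ℝ V, ∀ x, 0 ≤ ∑ y, b x y * w y := by
  classical
  by_contra! hno
  let L : (V → ℝ) →ₗ[ℝ] (V → ℝ) := Matrix.mulVecLin (Matrix.of b)
  have hL : ∀ w x, L w x = ∑ y, b x y * w y := fun w x => rfl
  have hdisj : Disjoint (L '' stdSimplex ℝ V) (Set.Ici 0) := by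
    rw [Set.disjoint_left]
    rintro _ ⟨w, hw, rfl⟩ hpos
    obtain ⟨x, hx⟩ := hno w hw
    exact absurd (hpos x) (not_le.mpr hx)
  obtain ⟨f, u, v, hu, huv, hv⟩ := geometric_hahn_banach_compact_closed
    ((convex_stdSimplex ℝ V).linear_image L)
    ((isCompact_stdSimplex ℝ V).image L.continuous_of_finiteDimensional)
    (convex_Ici (0 : V → ℝ)) isClosed_Ici hdisj
  have hv0 : v < 0 := by simpa using hv 0 Set.self_mem_Ici
  set p : V → ℝ := fun x => f (Pi.single x 1) with hp
  have hf : ∀ z, f z = ∑ x, z x * p x := fun z => by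
    conv_lhs => rw [pi_eq_sum_univ' z]
    simp only [map_sum, map_smul, smul_eq_mul, hp]
  have hp0 : ∀ x, 0 ≤ p x := by
    intro x
    by_contra! hneg
    have h := hv ((v / p x) • Pi.single x 1) (by
      rw [Set.mem_Ici]
      refine smul_nonneg (div_nonneg_of_nonpos hv0.le hneg.le) ?_
      exact Pi.single_nonneg.mpr zero_le_one)
    rw [map_smul, smul_eq_mul, div_mul_cancel₀ _ hneg.ne] at h
    exact lt_irrefl _ h
  have hskew : f (L p) = 0 := by
    have h : f (L p) = -f (L p) := by
      rw [hf]
      simp only [hL, Finset.sum_mul]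
      conv_lhs => rw [Finset.sum_comm]
      rw [← Finset.sum_neg_distrib]
      refine Finset.sum_congr rfl fun x _ => ?_
      rw [← Finset.sum_neg_distrib]
      refine Finset.sum_congr rfl fun y _ => ?_
      rw [hb y x]
      ring
    linarith
  have hs0 : 0 ≤ ∑ x, p x := Finset.sum_nonneg fun x _ => hp0 x
  have hs : ∑ x, p x ≠ 0 := by
    intro h
    have hpz : ∀ x, p x = 0 := fun x =>
      (Finset.sum_eq_zero_iff_of_nonneg fun x _ => hp0 x).mp h x (Finset.mem_univ x)
    obtain ⟨x⟩ := ‹Nonempty V›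
    have h1 := hu _ ⟨_, single_mem_stdSimplex ℝ x, rfl⟩
    rw [hf] at h1
    simp only [hpz, mul_zero, Finset.sum_const_zero] at h1
    linarith
  have h := hu _ ⟨(∑ x, p x)⁻¹ • p, ⟨fun x => mul_nonneg (inv_nonneg.mpr hs0) (hp0 x), by
    simp only [Pi.smul_apply, smul_eq_mul, ← Finset.mul_sum]
    exact inv_mul_cancel₀ hs⟩, rfl⟩
  rw [map_smul, map_smul, hskew, smul_zero] at h
  linarith

/-- A complete relation admits a probability distribution giving weight at least `1/2` to every
closed in-neighbourhood. -/
theorem exists_stdSimplex_half_le_setWeight {V : Type*} [Fintype V] [Nonempty V]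
    (R : V → V → Prop) (hR : ∀ x y, R x y ∨ R y x) :
    ∃ w ∈ stdSimplex ℝ V, ∀ x, 1 / 2 ≤ setWeight w {y | R y x} := by
  classical
  let a : V → V → ℝ := fun x y => if R y x then 1 else 0
  obtain ⟨w, hw, hpos⟩ := exists_stdSimplex_sum_nonneg_of_skew
    (fun x y => a x y - a y x) (fun x y => by ring)
  refine ⟨w, hw, fun x => ?_⟩
  have hset : setWeight w {y | R y x} = ∑ y, a x y * w y :=
    Finset.sum_congr rfl fun y _ => by simp [a, Set.indicator_apply]
  have hone : 1 ≤ ∑ y, (a x y + a y x) * w y := by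
    rw [← hw.2]
    refine Finset.sum_le_sum fun y _ => le_mul_of_one_le_left (hw.1 y) ?_
    rcases hR x y with h | h <;> simp only [a, h, if_true] <;> split_ifs <;> norm_num
  have hx := hpos x
  simp only [sub_mul, add_mul, Finset.sum_sub_distrib, Finset.sum_add_distrib] at hx hone
  linarith

/-- The weight of a finite union is at most the sum of the weights. -/
theorem setWeight_setOf_exists_le {V ι : Type*} [Fintype V] [Fintype ι] {w : V → ℝ}
    (hw : ∀ x, 0 ≤ w x) (p : ι → V → Prop) :
    setWeight w {y | ∃ i, p i y} ≤ ∑ i, setWeight w {y | p i y} := by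
  classical
  unfold setWeight
  rw [Finset.sum_comm]
  refine Finset.sum_le_sum fun y _ => ?_
  refine Set.indicator_le' (g := fun y => ∑ i, {y | p i y}.indicator w y) ?_
    (fun y _ => Finset.sum_nonneg fun i _ => Set.indicator_nonneg (fun x _ => hw x) y) y
  rintro z ⟨i, hi⟩
  calc w z = {y | p i y}.indicator w z := (Set.indicator_of_mem (s := {y | p i y}) hi w).symm
    _ ≤ ∑ i, {y | p i y}.indicator w z :=
      Finset.single_le_sum (f := fun i => {y | p i y}.indicator w z)
        (fun i _ => Set.indicator_nonneg (fun x _ => hw x) z) (Finset.mem_univ i)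

/-- If `T` is a complete multidigraph on a finite nonempty vertex set `V` whose arc set is
the union of `k ≥ 1` quasi-orders `P 1, …, P k`, then there exist a probability distribution
`w` on `V` and a partition of `V` into sets `T 1, …, T k` such that for every `i` and every
`x ∈ T i`, `w(N_i⁻(x)) ≥ 1/(2k)`, where `N_i⁻(x) = {x} ∪ {y | P i y x}`. -/
theorem exists_distribution_and_partition
    {V : Type*} [Fintype V] [Nonempty V] {k : ℕ} (hk : 1 ≤ k)
    (P : Fin k → V → V → Prop)
    (hrefl : ∀ i x, P i x x)
    (htrans : ∀ i x y z, P i x y → P i y z → P i x z)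
    (hcomplete : ∀ x y : V, x ≠ y → ∃ i, P i x y ∨ P i y x) :
    ∃ (w : V → ℝ) (T : Fin k → Set V),
      (∀ x, 0 ≤ w x ∧ w x ≤ 1) ∧ (∑ x, w x) = 1 ∧
      (Pairwise fun i j => Disjoint (T i) (T j)) ∧
      (⋃ i, T i) = Set.univ ∧
      ∀ i : Fin k, ∀ x ∈ T i,
        setWeight w {y | y = x ∨ P i y x} ≥ 1 / (2 * k) := by
  have : Nonempty (Fin k) := ⟨⟨0, hk⟩⟩
  obtain ⟨w, hw, hhalf⟩ := exists_stdSimplex_half_le_setWeight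
    (fun y x => ∃ i, y = x ∨ P i y x) (fun x y => by
      rcases eq_or_ne x y with rfl | hne
      · exact Or.inl ⟨⟨0, hk⟩, Or.inl rfl⟩
      · obtain ⟨i, h | h⟩ := hcomplete x y hne
        · exact Or.inl ⟨i, Or.inr h⟩
        · exact Or.inr ⟨i, Or.inr h⟩)
  have hcolour : ∀ x, ∃ i, 1 / (2 * k : ℝ) ≤ setWeight w {y | y = x ∨ P i y x} := by
    intro x
    have hk0 : (k : ℝ) ≠ 0 := by positivity
    have hsum : ∑ _i : Fin k, 1 / (2 * k : ℝ) ≤ ∑ i, setWeight w {y | y = x ∨ P i y x} := by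
      refine le_trans (le_of_eq ?_) ((hhalf x).trans (setWeight_setOf_exists_le hw.1 _))
      rw [Finset.sum_const, Finset.card_univ, Fintype.card_fin, nsmul_eq_mul]
      field_simp
    obtain ⟨i, -, hi⟩ := Finset.exists_le_of_sum_le Finset.univ_nonempty hsum
    exact ⟨i, hi⟩
  choose c hc using hcolour
  refine ⟨w, fun i => {x | c x = i}, fun x => ⟨hw.1 x, ?_⟩, hw.2, ?_, ?_, ?_⟩
  · rw [← hw.2]
    exact Finset.single_le_sum (fun y _ => hw.1 y) (Finset.mem_univ x)
  · intro i j hij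
    exact Set.disjoint_left.mpr fun x hi hj => hij (hi.symm.trans hj)
  · exact Set.eq_univ_of_forall fun x => Set.mem_iUnion.mpr ⟨c x, rfl⟩
  · rintro i x rfl
    exact hc x
end

section
/- Let 0 < ε < 1, let P be a quasi-order (reflexive transitive relation) on a finite set A, let B ⊆ A, let w_A be a probability distribution on A such that w_A(N^-(x)) ≥ ε for every x ∈ B, and let w_B be a probability distribution supported on B. Set g(ε) = ⌊ln(ε)/ln(1-ε)⌋ + 1. Then there exists a multiset S of g(ε) elements of A (i.e., a function S : {1,…,g(ε)} → A) such that w_B(N^+(S)) > 1 - ε, where N^+(S) = ⋃_{s ∈ S} ({s} ∪ {y ∈ A : P s y}). -/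
/-- `g(ε) = ⌊ln(ε)/ln(1-ε)⌋ + 1`. -/
noncomputable def gfun (ε : ℝ) : ℕ :=
  Nat.floor (Real.log ε / Real.log (1 - ε)) + 1

theorem setWeight_add_setWeight_compl {V : Type*} [Fintype V] (w : V → ℝ) (S : Set V) :
    setWeight w S + setWeight w Sᶜ = ∑ x, w x := by
  simp only [setWeight, ← Finset.sum_add_distrib, Set.indicator_self_add_compl_apply]

theorem sum_mul_setWeight_comm {V W : Type*} [Fintype V] [Fintype W] (R : V → W → Prop)
    (v : V → ℝ) (w : W → ℝ) :
    ∑ a, v a * setWeight w {x | R a x} = ∑ x, w x * setWeight v {a | R a x} := by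
  classical
  simp only [setWeight, Finset.mul_sum]
  rw [Finset.sum_comm]
  refine Finset.sum_congr rfl fun x _ => Finset.sum_congr rfl fun a _ => ?_
  by_cases h : R a x <;> simp [h, mul_comm]

/-- If every `x` in the support of `u` is related to a set of measure at least
`ε` under the distribution `w`, then a single element leaves at most a `1 - ε` proportion of the
weight `u` uncovered. -/
theorem exists_setWeight_not_rel_le {V : Type*} [Fintype V] {ε : ℝ} (R : V → V → Prop)
    (w : V → ℝ) (hw0 : ∀ a, 0 ≤ w a) (hw1 : ∑ a, w a = 1)
    (u : V → ℝ) (hu0 : ∀ x, 0 ≤ u x)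
    (hdense : ∀ x, u x ≠ 0 → ε ≤ setWeight w {a | R a x}) :
    ∃ a, setWeight u {x | ¬ R a x} ≤ (1 - ε) * ∑ x, u x := by
  have hne : (Finset.univ : Finset V).Nonempty :=
    Finset.nonempty_of_sum_ne_zero (hw1.trans_ne one_ne_zero)
  obtain ⟨a, -, ha⟩ :=
    Finset.exists_min_image Finset.univ (fun a => setWeight u {x | ¬ R a x}) hne
  refine ⟨a, ?_⟩
  calc setWeight u {x | ¬ R a x}
      = ∑ b, w b * setWeight u {x | ¬ R a x} := by rw [← Finset.sum_mul, hw1, one_mul]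
    _ ≤ ∑ b, w b * setWeight u {x | ¬ R b x} :=
        Finset.sum_le_sum fun b hb => mul_le_mul_of_nonneg_left (ha b hb) (hw0 b)
    _ = ∑ x, u x * setWeight w {b | ¬ R b x} :=
        sum_mul_setWeight_comm (fun b x => ¬ R b x) w u
    _ ≤ ∑ x, (1 - ε) * u x := by
        refine Finset.sum_le_sum fun x _ => ?_
        by_cases hx : u x = 0
        · simp [hx]
        · have hcompl := setWeight_add_setWeight_compl w {b | R b x}
          rw [Set.compl_ofPred, hw1] at hcompl
          rw [mul_comm]
          exact mul_le_mul_of_nonneg_right (by linarith [hdense x hx]) (hu0 x)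
    _ = (1 - ε) * ∑ x, u x := (Finset.mul_sum ..).symm

/-- Greedy covering: iterating `exists_setWeight_not_rel_le`, `n` elements leave at most a
`(1 - ε) ^ n` proportion uncovered. -/
theorem exists_setWeight_forall_not_rel_le {V : Type*} [Fintype V] {ε : ℝ} (hε1 : ε ≤ 1)
    (R : V → V → Prop) (w : V → ℝ) (hw0 : ∀ a, 0 ≤ w a) (hw1 : ∑ a, w a = 1)
    (u : V → ℝ) (hu0 : ∀ x, 0 ≤ u x)
    (hdense : ∀ x, u x ≠ 0 → ε ≤ setWeight w {a | R a x}) (n : ℕ) :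
    ∃ S : Fin n → V, setWeight u {x | ∀ j, ¬ R (S j) x} ≤ (1 - ε) ^ n * ∑ x, u x := by
  induction n with
  | zero => exact ⟨Fin.elim0, by simp [setWeight]⟩
  | succ n ih =>
    obtain ⟨S, hS⟩ := ih
    obtain ⟨a, ha⟩ := exists_setWeight_not_rel_le R w hw0 hw1
      ({x | ∀ j, ¬ R (S j) x}.indicator u)
      (fun x => Set.indicator_nonneg (fun x _ => hu0 x) x)
      (fun x hx => hdense x fun h => hx (Set.indicator_apply_eq_zero.2 fun _ => h))
    refine ⟨Fin.cons a S, ?_⟩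
    calc setWeight u {x | ∀ j, ¬ R ((Fin.cons a S : Fin (n + 1) → V) j) x}
        = setWeight ({x | ∀ j, ¬ R (S j) x}.indicator u) {x | ¬ R a x} := by
          simp only [setWeight, Set.indicator_indicator, Fin.forall_fin_succ, Fin.cons_zero,
            Fin.cons_succ, Set.ofPred_and]
      _ ≤ (1 - ε) * setWeight u {x | ∀ j, ¬ R (S j) x} := ha
      _ ≤ (1 - ε) * ((1 - ε) ^ n * ∑ x, u x) :=
          mul_le_mul_of_nonneg_left hS (sub_nonneg.2 hε1)
      _ = (1 - ε) ^ (n + 1) * ∑ x, u x := by ring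

theorem one_sub_pow_gfun_lt {ε : ℝ} (hε0 : 0 < ε) (hε1 : ε < 1) : (1 - ε) ^ gfun ε < ε := by
  have hlog : Real.log (1 - ε) < 0 := Real.log_neg (by linarith) (by linarith)
  have hfloor : Real.log ε / Real.log (1 - ε) < gfun ε := by
    simpa [gfun] using Nat.lt_floor_add_one (Real.log ε / Real.log (1 - ε))
  rw [div_lt_iff_of_neg hlog, ← Real.log_pow] at hfloor
  exact (Real.log_lt_log_iff (pow_pos (by linarith) _) hε0).1 hfloor

/-- Let `0 < ε < 1`, let `P` be a quasi-order on a finite set `A`, let `B ⊆ A`, let `wA` be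
a probability distribution on `A` with `wA(N⁻(x)) ≥ ε` for every `x ∈ B`, and let `wB` be a
probability distribution supported on `B`. Then there is a multiset `S` of `g(ε)` elements of
`A` (a function `Fin (g ε) → A`) with `wB(N⁺(S)) > 1 - ε`. -/
theorem exists_multiset_large_out_neighbourhood
    {A : Type*} [Fintype A] {ε : ℝ} (hε0 : 0 < ε) (hε1 : ε < 1)
    (P : A → A → Prop)
    (hrefl : ∀ x, P x x)
    (htrans : ∀ x y z, P x y → P y z → P x z)
    (B : Set A)
    (wA : A → ℝ) (hwA01 : ∀ x, 0 ≤ wA x ∧ wA x ≤ 1) (hwA1 : (∑ x, wA x) = 1)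
    (hdense : ∀ x ∈ B, setWeight wA {y | y = x ∨ P y x} ≥ ε)
    (wB : A → ℝ) (hwB01 : ∀ x, 0 ≤ wB x ∧ wB x ≤ 1) (hwB1 : (∑ x, wB x) = 1)
    (hsupp : ∀ x ∉ B, wB x = 0) :
    ∃ S : Fin (gfun ε) → A,
      setWeight wB {y | ∃ j, S j = y ∨ P (S j) y} > 1 - ε := by
  have hdense' : ∀ x, wB x ≠ 0 → ε ≤ setWeight wA {a | a = x ∨ P a x} := fun x hx =>
    hdense x (not_imp_comm.1 (hsupp x) hx)
  obtain ⟨S, hS⟩ := exists_setWeight_forall_not_rel_le hε1.le (fun a x => a = x ∨ P a x)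
    wA (fun a => (hwA01 a).1) hwA1 wB (fun x => (hwB01 x).1) hdense' (gfun ε)
  refine ⟨S, ?_⟩
  have hcompl := setWeight_add_setWeight_compl wB {y | ∃ j, S j = y ∨ P (S j) y}
  simp only [Set.compl_ofPred, not_exists] at hcompl
  have hpow := one_sub_pow_gfun_lt hε0 hε1
  rw [hwB1] at hS hcompl
  linarith
end

section
/- Let 0 < ε < 1 and set g(ε) = ⌊ln(ε)/ln(1-ε)⌋ + 1. Let P be a quasi-order (reflexive transitive relation) on a finite set A, and let C ⊆ B ⊆ A be such that B is ε-dense in P (i.e., there is a probability distribution w_A on A with w_A(N^-(x)) ≥ ε for every x ∈ B) and C is ε-dense in B (i.e., there is a probability distribution w_B supported on B with w_B(N^-(x) ∩ B) ≥ ε for every x ∈ C). Then there exists a set S ⊆ A with |S| ≤ g(ε) such that every element of C lies in N^+(S), i.e., for every y ∈ C there exists s ∈ S with s = y or P s y. -/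
open Classical in
/-- Averaging: if every point of positive `u`-weight has in-neighbourhood of `w`-weight at least
`ε`, then some out-neighbourhood carries at least an `ε`-fraction of `u`. -/
theorem exists_outNeighbourhood_weight_ge {A : Type*} [Fintype A] {ε : ℝ} (P : A → A → Prop)
    (w u : A → ℝ) (hw : ∀ x, 0 ≤ w x) (hw1 : ∑ x, w x = 1) (hu : ∀ x, 0 ≤ u x)
    (h : ∀ y, u y ≠ 0 → ε ≤ ∑ x, if P x y then w x else 0) :
    ∃ a, ε * ∑ y, u y ≤ ∑ y, if P a y then u y else 0 := by
  have hne : (Finset.univ : Finset A).Nonempty := by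
    by_contra hn
    rw [Finset.not_nonempty_iff_eq_empty] at hn
    simp [hn] at hw1
  obtain ⟨a, -, ha⟩ :=
    Finset.exists_max_image Finset.univ (fun a => ∑ y, if P a y then u y else 0) hne
  refine ⟨a, ?_⟩
  calc ε * ∑ y, u y = ∑ y, ε * u y := Finset.mul_sum _ _ _
    _ ≤ ∑ y, (∑ x, if P x y then w x else 0) * u y := by
        refine Finset.sum_le_sum fun y _ => ?_
        by_cases hy : u y = 0
        · simp [hy]
        · exact mul_le_mul_of_nonneg_right (h y hy) (hu y)
    _ = ∑ x, w x * ∑ y, if P x y then u y else 0 := by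
        simp only [Finset.sum_mul, Finset.mul_sum]
        rw [Finset.sum_comm]
        refine Finset.sum_congr rfl fun x _ => Finset.sum_congr rfl fun y _ => ?_
        split_ifs <;> simp
    _ ≤ ∑ x, w x * ∑ y, if P a y then u y else 0 :=
        Finset.sum_le_sum fun x hx => mul_le_mul_of_nonneg_left (ha x hx) (hw x)
    _ = ∑ y, if P a y then u y else 0 := by rw [← Finset.sum_mul, hw1, one_mul]

open Classical in
/-- Greedy choice: `k` points suffice to leave at most a `(1 - ε) ^ k` fraction of the weight `u`
undominated. -/
theorem exists_card_le_undominated_weight_le {A : Type*} [Fintype A] {ε : ℝ} (hε1 : ε < 1)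
    (P : A → A → Prop) (w u : A → ℝ) (hw : ∀ x, 0 ≤ w x) (hw1 : ∑ x, w x = 1)
    (hu : ∀ x, 0 ≤ u x) (h : ∀ y, u y ≠ 0 → ε ≤ ∑ x, if P x y then w x else 0) (k : ℕ) :
    ∃ S : Finset A, S.card ≤ k ∧
      (∑ y, if ∃ s ∈ S, P s y then 0 else u y) ≤ (1 - ε) ^ k * ∑ y, u y := by
  induction k with
  | zero => exact ⟨∅, by simp⟩
  | succ k ih =>
    obtain ⟨S, hS, hSu⟩ := ih
    obtain ⟨a, ha⟩ := exists_outNeighbourhood_weight_ge (ε := ε) P w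
      (fun y => if ∃ s ∈ S, P s y then 0 else u y) hw hw1
      (fun y => by split_ifs <;> simp [hu])
      (fun y hy => h y fun h0 => hy (by simp [h0]))
    refine ⟨insert a S, (Finset.card_insert_le _ _).trans (by omega), ?_⟩
    have key : (∑ y, if ∃ s ∈ insert a S, P s y then 0 else u y) =
        (∑ y, if ∃ s ∈ S, P s y then 0 else u y) -
          ∑ y, if P a y then (if ∃ s ∈ S, P s y then 0 else u y) else 0 := by
      rw [← Finset.sum_sub_distrib]
      refine Finset.sum_congr rfl fun y _ => ?_
      simp only [Finset.exists_mem_insert]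
      by_cases h1 : P a y <;> by_cases h2 : ∃ s ∈ S, P s y <;> simp [h1, h2]
    rw [key, pow_succ]
    have := mul_le_mul_of_nonneg_left hSu (sub_nonneg.2 hε1.le)
    linarith

/-- Let `0 < ε < 1`, let `P` be a quasi-order on a finite set `A`, and let `C ⊆ B ⊆ A` be
such that `B` is `ε`-dense in `P` (witnessed by a probability distribution `wA` on `A` with
`wA(N⁻(x)) ≥ ε` for all `x ∈ B`) and `C` is `ε`-dense in `B` (witnessed by a probability
distribution `wB` supported on `B` with `wB(N⁻(x) ∩ B) ≥ ε` for all `x ∈ C`). Then there is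
a set `S ⊆ A` with `|S| ≤ g(ε)` dominating `C`: every `y ∈ C` satisfies `s = y` or `P s y`
for some `s ∈ S`. -/
theorem exists_small_dominating_set_of_dense
    {A : Type*} [Fintype A] {ε : ℝ} (hε0 : 0 < ε) (hε1 : ε < 1)
    (P : A → A → Prop)
    (hrefl : ∀ x, P x x)
    (htrans : ∀ x y z, P x y → P y z → P x z)
    (B C : Set A) (hCB : C ⊆ B)
    (hBdense : ∃ wA : A → ℝ, (∀ x, 0 ≤ wA x ∧ wA x ≤ 1) ∧ (∑ x, wA x) = 1 ∧
      ∀ x ∈ B, setWeight wA {y | y = x ∨ P y x} ≥ ε)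
    (hCdense : ∃ wB : A → ℝ, (∀ x, 0 ≤ wB x ∧ wB x ≤ 1) ∧ (∑ x, wB x) = 1 ∧
      (∀ x ∉ B, wB x = 0) ∧
      ∀ x ∈ C, setWeight wB ({y | y = x ∨ P y x} ∩ B) ≥ ε) :
    ∃ S : Finset A, S.card ≤ gfun ε ∧ ∀ y ∈ C, ∃ s ∈ S, s = y ∨ P s y := by
  classical
  obtain ⟨wA, hA0, hA1, hA⟩ := hBdense
  obtain ⟨wB, hB0, hB1, hBs, hB⟩ := hCdense
  have hnbr (x : A) : {y | y = x ∨ P y x} = {y | P y x} := by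
    ext y
    exact ⟨fun h => h.elim (fun h => h ▸ hrefl _) id, Or.inr⟩
  obtain ⟨S, hS, hSw⟩ := exists_card_le_undominated_weight_le hε1 P wA wB
    (fun x => (hA0 x).1) hA1 (fun x => (hB0 x).1)
    (fun y hy => by
      have h := hA y (by_contra fun hyB => hy (hBs y hyB))
      rw [hnbr] at h
      simpa [setWeight, Set.indicator_apply] using h) (gfun ε)
  refine ⟨S, hS, fun x hx => ?_⟩
  by_contra hn
  have hxn : ∀ s ∈ S, ¬ P s x := fun s hs hsx => hn ⟨s, hs, Or.inr hsx⟩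
  have hle : setWeight wB ({y | y = x ∨ P y x} ∩ B) ≤
      ∑ y, if ∃ s ∈ S, P s y then 0 else wB y := by
    rw [hnbr]
    refine Finset.sum_le_sum fun y _ => ?_
    by_cases hd : ∃ s ∈ S, P s y
    · obtain ⟨s, hs, hsy⟩ := hd
      have hy : y ∉ {y | P y x} ∩ B := fun hy => hxn s hs (htrans _ _ _ hsy hy.1)
      rw [Set.indicator_of_notMem hy, if_pos ⟨s, hs, hsy⟩]
    · rw [if_neg hd]
      exact Set.indicator_apply_le' (fun _ => le_rfl) fun _ => (hB0 y).1
  rw [hB1, mul_one] at hSw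
  linarith [hB x hx, one_sub_pow_gfun_lt hε0 hε1]
end
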